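/- Let H ∈ (0,1), a, b > 0, f(s) = (s^{2H} + 1 − (1−s)^{2H})/2, and let s* ∈ (0,1) be the unique minimizer on (0,1) of D_{b/a}(s) = ((b/a) + f(s))²/(s^{2H} − f(s)²) + 1. Then the following identity holds: (s*^{2H−1} + (1−s*)^{2H−1})·(a·s*^{2H} + b·f(s*)) = s*^{2H−1}·(a·f(s*) + b). -/

import Mathlib

open Real Set

/-- The determinant of the fractional Brownian covariance at times `s` and `1` is positive
for `0 < s < 1`. -/
theorem fbm_covariance_det_pos {H s : ℝ} (hH : H ∈ Set.Ioo (0 : ℝ) 1)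
    (hs : s ∈ Set.Ioo (0 : ℝ) 1) :
    0 < s ^ (2 * H) - ((s ^ (2 * H) + 1 - (1 - s) ^ (2 * H)) / 2) ^ 2 := by
  obtain ⟨hH0, hH1⟩ := hH
  obtain ⟨hs0, hs1⟩ := hs
  have ht0 : 0 < 1 - s := sub_pos.mpr hs1
  have hx : s < s ^ H := Real.self_lt_rpow_of_lt_one hs0 hs1 hH1
  have hy : 1 - s < (1 - s) ^ H := Real.self_lt_rpow_of_lt_one ht0 (by linarith) hH1
  have hy1 : (1 - s) ^ H < 1 := Real.rpow_lt_one ht0.le (by linarith) hH0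
  have hsq : ∀ t : ℝ, 0 < t → t ^ (2 * H) = (t ^ H) ^ 2 := fun t ht => by
    rw [← Real.rpow_mul_natCast ht.le, mul_comm 2 H, Nat.cast_ofNat]
  rw [hsq s hs0, hsq (1 - s) ht0]
  set x := s ^ H
  set y := (1 - s) ^ H
  have factored : x ^ 2 - ((x ^ 2 + 1 - y ^ 2) / 2) ^ 2
      = (y - 1 + x) * (y + 1 - x) * (1 + x - y) * (1 + x + y) / 4 := by ring
  have hx1 : x < 1 := Real.rpow_lt_one hs0.le hs1 hH0
  rw [factored]
  have h1 : 0 < y - 1 + x := by linarith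
  have h2 : 0 < y + 1 - x := by linarith
  have h3 : 0 < 1 + x - y := by linarith
  have h4 : 0 < 1 + x + y := by linarith
  positivity

/-- First-order optimality identity at the unique minimizer `s* ∈ (0,1)` of
`D_{b/a}(s) = ((b/a) + f(s))²/(s^{2H} − f(s)²) + 1`, where
`f(s) = (s^{2H} + 1 − (1−s)^{2H})/2`:
`(s*^{2H−1} + (1−s*)^{2H−1})·(a·s*^{2H} + b·f(s*)) = s*^{2H−1}·(a·f(s*) + b)`. -/
theorem stmt_8 (H a b : ℝ) (hH : H ∈ Set.Ioo (0 : ℝ) 1) (ha : 0 < a) (hb : 0 < b)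
    (f D : ℝ → ℝ)
    (hf : ∀ s, f s = (s ^ (2 * H) + 1 - (1 - s) ^ (2 * H)) / 2)
    (hD : ∀ s, D s = (b / a + f s) ^ 2 / (s ^ (2 * H) - (f s) ^ 2) + 1)
    (s₀ : ℝ) (hs₀ : s₀ ∈ Set.Ioo (0 : ℝ) 1)
    (hmin : ∀ s ∈ Set.Ioo (0 : ℝ) 1, s ≠ s₀ → D s₀ < D s) :
    (s₀ ^ (2 * H - 1) + (1 - s₀) ^ (2 * H - 1)) * (a * s₀ ^ (2 * H) + b * f s₀)
      = s₀ ^ (2 * H - 1) * (a * f s₀ + b) := by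
  obtain ⟨hH0, hH1⟩ := id hH
  obtain ⟨h0, h1⟩ := id hs₀
  have ht0 : 0 < 1 - s₀ := sub_pos.mpr h1
  have hV : 0 < s₀ ^ (2 * H) - f s₀ ^ 2 := by
    rw [hf]
    exact fbm_covariance_det_pos hH hs₀
  have hN : 0 < b / a + f s₀ := by
    have hy1 : (1 - s₀) ^ (2 * H) < 1 := Real.rpow_lt_one ht0.le (by linarith) (by linarith)
    have hx0 : 0 < s₀ ^ (2 * H) := Real.rpow_pos_of_pos h0 _
    have hc : 0 < b / a := div_pos hb ha
    rw [hf]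
    linarith
  have hdS : HasDerivAt (fun s : ℝ => s ^ (2 * H)) (2 * H * s₀ ^ (2 * H - 1)) s₀ :=
    Real.hasDerivAt_rpow_const (Or.inl h0.ne')
  have hdT : HasDerivAt (fun s : ℝ => (1 - s) ^ (2 * H))
      (-1 * (2 * H) * (1 - s₀) ^ (2 * H - 1)) s₀ :=
    ((hasDerivAt_id' s₀).const_sub 1).rpow_const (Or.inl ht0.ne')
  have hdf : HasDerivAt f (H * (s₀ ^ (2 * H - 1) + (1 - s₀) ^ (2 * H - 1))) s₀ := by
    rw [funext hf]
    exact (((hdS.add_const 1).sub hdT).div_const 2).congr_deriv (by ring)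
  have hdD := (((hdf.const_add (b / a)).fun_pow 2).fun_div (hdS.fun_sub (hdf.fun_pow 2))
    hV.ne').add_const 1
  have hlocal : IsLocalMin D s₀ := by
    filter_upwards [Ioo_mem_nhds h0 h1] with s hs
    rcases eq_or_ne s s₀ with rfl | hne
    · exact le_rfl
    · exact (hmin s hs hne).le
  rw [funext hD] at hlocal
  have hzero := hlocal.hasDerivAt_eq_zero hdD
  rw [div_eq_zero_iff, or_iff_left (pow_pos hV 2).ne'] at hzero
  have hb' : b = b / a * a := by field_simp
  generalize b / a = c at *
  subst hb'
  refine mul_left_cancel₀ (mul_pos (mul_pos two_pos hH0) hN).ne' ?_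
  push_cast at hzero
  linear_combination a * hzero
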